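/- arXiv:math/0701422 — 3 statements merged into one kernel-verified Lean document; each statement's English description precedes it below -/
import Mathlib

section
/- Let p ≥ 2, let n_1, …, n_p be positive integers, and let G be obtained from the complete p-partite graph K_{n_1, n_2, …, n_p} by deleting a set T of k edges. Then there exists a set S of at most k edges of the complete (p−1)-partite graph K_{n_1+n_2, n_3, …, n_p} such that the graph K_{n_1+n_2, n_3, …, n_p} with the edges of S deleted is a minor of G. -/
/-- `H` is a minor of `G`: there is an assignment of branch sets of `G`
(the fibers `f ⁻¹' {some w}`) to the vertices of `H`, each nonempty and
connected, such that every edge of `H` is realized by an edge of `G`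
between the corresponding branch sets. Vertices mapped to `none` are deleted. -/
def SimpleGraph.IsMinorOf {W V : Type*} (H : SimpleGraph W) (G : SimpleGraph V) : Prop :=
  ∃ f : V → Option W,
    (∀ w : W, ∃ v : V, f v = some w) ∧
    (∀ w : W, (G.induce {v | f v = some w}).Connected) ∧
    (∀ w₁ w₂ : W, H.Adj w₁ w₂ →
      ∃ v₁ v₂ : V, f v₁ = some w₁ ∧ f v₂ = some w₂ ∧ G.Adj v₁ v₂)

/-- The part sizes obtained from `n : Fin (p+2) → ℕ` by merging the first two parts:
the new first part has size `n 0 + n 1` and the remaining parts keep their sizes. -/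
def mergedSizes (p : ℕ) (n : Fin (p + 2) → ℕ) : Fin (p + 1) → ℕ :=
  Fin.cases (n 0 + n 1) (fun j : Fin p => n j.succ.succ)

/-- A graph that embeds injectively into `G` (as a not necessarily induced subgraph) is a minor
of `G`, with singleton branch sets. -/
theorem SimpleGraph.IsMinorOf.of_injective_hom {W V : Type*} {H : SimpleGraph W}
    {G : SimpleGraph V} (φ : H →g G) (hφ : Function.Injective φ) : H.IsMinorOf G := by
  have apply_eq : ∀ w, Function.partialInv φ (φ w) = some w :=
    fun w => Function.partialInv_left hφ w
  refine ⟨Function.partialInv φ, fun w => ⟨φ w, apply_eq w⟩, fun w => ?_,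
    fun w₁ w₂ h => ⟨φ w₁, φ w₂, apply_eq w₁, apply_eq w₂, φ.map_adj h⟩⟩
  have : Nonempty {v | Function.partialInv φ v = some w} := ⟨⟨φ w, apply_eq w⟩⟩
  have : Subsingleton {v | Function.partialInv φ v = some w} := by
    refine ⟨fun u v => Subtype.ext ?_⟩
    rw [← (Function.Injective.isPartialInv hφ w u).1 u.2,
      ← (Function.Injective.isPartialInv hφ w v).1 v.2]
  exact ⟨SimpleGraph.Preconnected.of_subsingleton⟩

/-- If `H` maps injectively into `K`, then deleting a finite set `T` of edges of `K` costs at most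
`T.card` edges of `H`, in the minor order. -/
theorem SimpleGraph.exists_deleteEdges_isMinorOf_of_injective_hom {W V : Type*}
    {H : SimpleGraph W} {K : SimpleGraph V} (φ : H →g K) (hφ : Function.Injective φ)
    (T : Finset (Sym2 V)) :
    ∃ S : Finset (Sym2 W), ↑S ⊆ H.edgeSet ∧ S.card ≤ T.card ∧
      (H.deleteEdges ↑S).IsMinorOf (K.deleteEdges ↑T) := by
  classical
  have hinj := Sym2.map.injective hφ
  refine ⟨(T.preimage (Sym2.map φ) hinj.injOn).filter (· ∈ H.edgeSet), fun e he => by simp_all,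
    (Finset.card_filter_le _ _).trans ?_, ?_⟩
  · exact Finset.card_le_card_of_injOn (Sym2.map φ) (fun e he => by simpa using he) hinj.injOn
  · refine .of_injective_hom ⟨φ, fun {a b} hab => ?_⟩ hφ
    rw [SimpleGraph.deleteEdges_adj] at hab ⊢
    refine ⟨φ.map_adj hab.1, fun hT => hab.2 ?_⟩
    simpa [hab.1] using hT

/-- The identification of the vertices of `K_{n₁+n₂, n₃, …, n_p}` with those of
`K_{n₁, …, n_p}`, splitting the first part into two. -/
def splitFirstPart (p : ℕ) (n : Fin (p + 2) → ℕ) (v : Σ i : Fin (p + 1), Fin (mergedSizes p n i)) :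
    Σ i : Fin (p + 2), Fin (n i) :=
  Fin.cases (motive := fun i => Fin (mergedSizes p n i) → Σ i : Fin (p + 2), Fin (n i))
    (fun x : Fin (n 0 + n 1) => Fin.addCases (fun a => ⟨0, a⟩) (fun b => ⟨1, b⟩) x)
    (fun j x => ⟨j.succ.succ, x⟩) v.1 v.2

theorem splitFirstPart_zero_castAdd (p : ℕ) (n : Fin (p + 2) → ℕ) (a : Fin (n 0)) :
    splitFirstPart p n ⟨0, Fin.castAdd (n 1) a⟩ = ⟨0, a⟩ :=
  Fin.addCases_left (motive := fun _ => Σ i : Fin (p + 2), Fin (n i)) a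

theorem splitFirstPart_zero_natAdd (p : ℕ) (n : Fin (p + 2) → ℕ) (b : Fin (n 1)) :
    splitFirstPart p n ⟨0, Fin.natAdd (n 0) b⟩ = ⟨1, b⟩ :=
  Fin.addCases_right (motive := fun _ => Σ i : Fin (p + 2), Fin (n i)) b

theorem splitFirstPart_succ (p : ℕ) (n : Fin (p + 2) → ℕ) (j : Fin p) (x : Fin (n j.succ.succ)) :
    splitFirstPart p n ⟨j.succ, x⟩ = ⟨j.succ.succ, x⟩ :=
  rfl

/-- Every vertex of `K_{n₁+n₂, n₃, …, n_p}` lies in the first `n₁` or the last `n₂` vertices of the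
merged part, or in one of the other parts. -/
theorem mergedSizes_sigma_cases {p : ℕ} {n : Fin (p + 2) → ℕ}
    {motive : (Σ i : Fin (p + 1), Fin (mergedSizes p n i)) → Prop}
    (left : ∀ a : Fin (n 0), motive ⟨0, Fin.castAdd (n 1) a⟩)
    (right : ∀ b : Fin (n 1), motive ⟨0, Fin.natAdd (n 0) b⟩)
    (other : ∀ (j : Fin p) (x : Fin (n j.succ.succ)), motive ⟨j.succ, x⟩)
    (v : Σ i : Fin (p + 1), Fin (mergedSizes p n i)) : motive v := by
  obtain ⟨i, x⟩ := v
  induction i using Fin.cases with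
  | zero => exact Fin.addCases (motive := fun x : Fin (n 0 + n 1) => motive ⟨0, x⟩) left right x
  | succ j => exact other j x

theorem splitFirstPart_injective (p : ℕ) (n : Fin (p + 2) → ℕ) :
    Function.Injective (splitFirstPart p n) := by
  /- A left inverse on vertices, rejoining the first two parts. -/
  let g : (Σ i : Fin (p + 2), Fin (n i)) → Σ i : Fin (p + 1), Fin (mergedSizes p n i) := fun v =>
    Fin.cases (motive := fun i => Fin (n i) → Σ i : Fin (p + 1), Fin (mergedSizes p n i))
      (fun a => ⟨0, Fin.castAdd (n 1) a⟩)
      (Fin.cases (fun b => ⟨0, Fin.natAdd (n 0) b⟩) fun j x => ⟨j.succ, x⟩) v.1 v.2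
  refine Function.LeftInverse.injective (g := g) fun v => ?_
  induction v using mergedSizes_sigma_cases with
  | left a => rw [splitFirstPart_zero_castAdd]; rfl
  | right b => rw [splitFirstPart_zero_natAdd]; rfl
  | other j x => rfl

/-- Splitting the first part preserves the property of lying in different parts. -/
theorem splitFirstPart_fst_ne (p : ℕ) (n : Fin (p + 2) → ℕ)
    {u v : Σ i : Fin (p + 1), Fin (mergedSizes p n i)} (h : u.1 ≠ v.1) :
    (splitFirstPart p n u).1 ≠ (splitFirstPart p n v).1 := by
  /- Merging the first two indices recovers the original part. -/
  have key : ∀ w, Fin.predAbove 0 (splitFirstPart p n w).1 = w.1 := fun w => by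
    induction w using mergedSizes_sigma_cases with
    | left a => rw [splitFirstPart_zero_castAdd]; rfl
    | right b => rw [splitFirstPart_zero_natAdd]; rfl
    | other j x => rw [splitFirstPart_succ]; simp
  exact fun huv => h (by rw [← key u, ← key v, huv])

/-- If `G` is obtained from `K_{n₁, …, n_p}` (`p ≥ 2`, all `nᵢ ≥ 1`) by deleting a set `T`
of `k` edges, then there is a set `S` of at most `k` edges of `K_{n₁+n₂, n₃, …, n_p}` such
that `K_{n₁+n₂, n₃, …, n_p}` minus `S` is a minor of `G`. -/
theorem combine_parts_minor_deficient (p : ℕ) (n : Fin (p + 2) → ℕ) (hpos : ∀ i, 0 < n i)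
    (k : ℕ) (T : Finset (Sym2 (Σ i : Fin (p + 2), Fin (n i))))
    (hT : ↑T ⊆ (SimpleGraph.completeMultipartiteGraph (fun i : Fin (p + 2) => Fin (n i))).edgeSet)
    (hTk : T.card = k) :
    ∃ S : Finset (Sym2 (Σ i : Fin (p + 1), Fin (mergedSizes p n i))),
      ↑S ⊆ (SimpleGraph.completeMultipartiteGraph
              (fun i : Fin (p + 1) => Fin (mergedSizes p n i))).edgeSet ∧
      S.card ≤ k ∧
      ((SimpleGraph.completeMultipartiteGraph
          (fun i : Fin (p + 1) => Fin (mergedSizes p n i))).deleteEdges ↑S).IsMinorOf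
        ((SimpleGraph.completeMultipartiteGraph
            (fun i : Fin (p + 2) => Fin (n i))).deleteEdges ↑T) := by
  obtain rfl := hTk
  exact SimpleGraph.exists_deleteEdges_isMinorOf_of_injective_hom
    ⟨splitFirstPart p n, fun h => splitFirstPart_fst_ne p n h⟩ (splitFirstPart_injective p n) T
end

section
/- For every edge e of the complete tripartite graph K_{3,3,2}, the graph K_{3,3,2} − e (K_{3,3,2} with the edge e deleted) contains the complete tripartite graph K_{3,3,1} as a minor. -/
open SimpleGraph

/-- A family of disjoint branch sets, each with a dominating vertex, witnesses a minor. -/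
theorem SimpleGraph.IsMinorOf.of_dominated {W V : Type*} {H : SimpleGraph W} {G : SimpleGraph V}
    (f : V → Option W)
    (hdom : ∀ w, ∃ v, f v = some w ∧ ∀ u, f u = some w → u ≠ v → G.Adj v u)
    (hadj : ∀ w₁ w₂, H.Adj w₁ w₂ → ∃ v₁, f v₁ = some w₁ ∧ ∃ v₂, f v₂ = some w₂ ∧ G.Adj v₁ v₂) :
    H.IsMinorOf G := by
  refine ⟨f, fun w => (hdom w).imp fun _ h => h.1, fun w => ?_, fun w₁ w₂ h =>
    let ⟨v₁, h₁, v₂, h₂, hG⟩ := hadj w₁ w₂ h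
    ⟨v₁, v₂, h₁, h₂, hG⟩⟩
  obtain ⟨v, hv, hvu⟩ := hdom w
  rw [connected_iff_exists_forall_reachable]
  refine ⟨⟨v, hv⟩, fun ⟨u, hu⟩ => ?_⟩
  by_cases huv : u = v
  · subst huv
    exact Reachable.refl _
  · exact Adj.reachable (hvu u hu huv)

instance SimpleGraph.completeMultipartiteGraph.decidableAdj {ι : Type*} [DecidableEq ι]
    (V : ι → Type*) : DecidableRel (completeMultipartiteGraph V).Adj :=
  fun v u => inferInstanceAs (Decidable (v.1 ≠ u.1))

instance SimpleGraph.deleteEdges.decidableAdjSingleton {V : Type*} [DecidableEq V]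
    (G : SimpleGraph V) [DecidableRel G.Adj] (e : Sym2 V) :
    DecidableRel (G.deleteEdges {e}).Adj :=
  fun _ _ => decidable_of_iff _ deleteEdges_adj.symm

/-- Branch sets in `K_{3,3,2}`: the vertex `k` of the part of size two is sent to `d`, and every
other vertex to the corresponding vertex of `K_{3,3,1}`. -/
def k332BranchMap (k : Fin 2) (d : Option (Σ i : Fin 3, Fin (![3, 3, 1] i))) :
    (Σ i : Fin 3, Fin (![3, 3, 2] i)) → Option (Σ i : Fin 3, Fin (![3, 3, 1] i))
  | ⟨0, x⟩ => some ⟨0, x⟩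
  | ⟨1, x⟩ => some ⟨1, x⟩
  | ⟨2, (x : Fin 2)⟩ => if x = k then d else some ⟨2, (0 : Fin 1)⟩

set_option synthInstance.maxSize 256 in
/-- Deleting an edge at a vertex of the part of size two: drop that vertex. -/
theorem k331_minor_of_k332_minus_edge_to_small_part
    (x : Σ i : Fin 3, Fin (![3, 3, 2] i)) (k : Fin 2) :
    (completeMultipartiteGraph (fun i : Fin 3 => Fin (![3, 3, 1] i))).IsMinorOf
      ((completeMultipartiteGraph (fun i : Fin 3 => Fin (![3, 3, 2] i))).deleteEdges
        {s(x, ⟨2, k⟩)}) := by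
  apply IsMinorOf.of_dominated (k332BranchMap k none) <;>
    revert x k <;> decide +kernel

/-- Deleting an edge between the two parts of size three: contract an edge joining its second
end to the part of size two. -/
theorem k331_minor_of_k332_minus_edge_between_large_parts (a b : Fin 3) :
    (completeMultipartiteGraph (fun i : Fin 3 => Fin (![3, 3, 1] i))).IsMinorOf
      ((completeMultipartiteGraph (fun i : Fin 3 => Fin (![3, 3, 2] i))).deleteEdges
        {s(⟨0, a⟩, ⟨1, b⟩)}) := by
  apply IsMinorOf.of_dominated (k332BranchMap 0 (some ⟨1, (b : Fin 3)⟩)) <;>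
    revert a b <;> decide +kernel

/-- For every edge `e` of `K_{3,3,2}`, the graph `K_{3,3,2} - e` contains `K_{3,3,1}`
as a minor. -/
theorem k331_minor_of_k332_minus_edge
    (e : Sym2 (Σ i : Fin 3, Fin (![3, 3, 2] i)))
    (he : e ∈ (SimpleGraph.completeMultipartiteGraph
        (fun i : Fin 3 => Fin (![3, 3, 2] i))).edgeSet) :
    (SimpleGraph.completeMultipartiteGraph
        (fun i : Fin 3 => Fin (![3, 3, 1] i))).IsMinorOf
      ((SimpleGraph.completeMultipartiteGraph
          (fun i : Fin 3 => Fin (![3, 3, 2] i))).deleteEdges {e}) := by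
  induction e using Sym2.ind with
  | _ x y =>
    wlog hxy : x.1 < y.1 generalizing x y
    · rw [Sym2.eq_swap] at he ⊢
      exact this y x he (lt_of_le_of_ne (not_lt.mp hxy) he)
    obtain ⟨i, a⟩ := x
    obtain ⟨j, b⟩ := y
    fin_cases j
    · exact absurd hxy (Fin.not_lt_zero i)
    · obtain rfl : i = 0 := Fin.lt_one_iff i |>.mp hxy
      exact k331_minor_of_k332_minus_edge_between_large_parts a b
    · exact k331_minor_of_k332_minus_edge_to_small_part ⟨i, a⟩ b
end

section
/- For every edge e of the complete tripartite graph K_{4,3,1}, the graph K_{4,3,1} − e (K_{4,3,1} with the edge e deleted) contains, as a minor, the complete bipartite graph K_{4,4} with one edge deleted. -/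
/-- A graph contained in `G` is a minor of `G`, with singleton branch sets. -/
theorem SimpleGraph.Copy.isMinorOf {W V : Type*} {H : SimpleGraph W} {G : SimpleGraph V}
    (φ : H.Copy G) : H.IsMinorOf G := by
  have hφ : ∀ w v, Function.partialInv φ v = some w ↔ φ w = v :=
    φ.injective.isPartialInv
  refine ⟨Function.partialInv φ, fun w => ⟨φ w, (hφ _ _).2 rfl⟩, fun w => ?_,
    fun w₁ w₂ h => ⟨φ w₁, φ w₂, (hφ _ _).2 rfl, (hφ _ _).2 rfl, φ.toHom.map_adj h⟩⟩
  have : Subsingleton {v | Function.partialInv φ v = some w} :=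
    ⟨fun a b => Subtype.ext (((hφ _ _).1 a.2).symm.trans ((hφ _ _).1 b.2))⟩
  have : Nonempty {v | Function.partialInv φ v = some w} := ⟨⟨φ w, (hφ _ _).2 rfl⟩⟩
  exact ⟨SimpleGraph.Preconnected.of_subsingleton⟩

/-- Deleting one edge of a graph containing a copy of `H` leaves a copy of `H` minus an edge. -/
theorem SimpleGraph.Copy.exists_deleteEdges_copy {W V : Type*} {H : SimpleGraph W}
    {G : SimpleGraph V} (φ : H.Copy G) (hH : H.edgeSet.Nonempty) (e : Sym2 V) :
    ∃ e' ∈ H.edgeSet, Nonempty ((H.deleteEdges {e'}).Copy (G.deleteEdges {e})) := by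
  obtain ⟨e', he', h⟩ : ∃ e' ∈ H.edgeSet, ∀ d ∈ H.edgeSet, d.map φ = e → d = e' := by
    by_cases hex : ∃ e' ∈ H.edgeSet, e'.map φ = e
    · obtain ⟨e', he', rfl⟩ := hex
      exact ⟨e', he', fun d _ hd => Sym2.map.injective φ.injective hd⟩
    · obtain ⟨e', he'⟩ := hH
      exact ⟨e', he', fun d hd hde => (hex ⟨d, hd, hde⟩).elim⟩
  refine ⟨e', he', ⟨⟨⟨φ, fun {a b} hab => ?_⟩, φ.injective⟩⟩⟩
  rw [SimpleGraph.deleteEdges_adj] at hab ⊢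
  exact ⟨φ.toHom.map_adj hab.1, fun hmem => hab.2 (h s(a, b) hab.1 hmem)⟩

/-- The copy of `K_{4,4}` in `K_{4,3,1}` obtained by merging the parts of sizes `3` and `1`. -/
def copyK44K431 : (completeBipartiteGraph (Fin 4) (Fin 4)).Copy
    (SimpleGraph.completeMultipartiteGraph (fun i : Fin 3 => Fin (![4, 3, 1] i))) where
  toHom :=
    { toFun := Sum.elim (fun i => ⟨0, i⟩)
        ![⟨1, (0 : Fin 3)⟩, ⟨1, (1 : Fin 3)⟩, ⟨1, (2 : Fin 3)⟩, ⟨2, (0 : Fin 1)⟩]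
      map_rel' := by
        simp only [completeBipartiteGraph_adj, SimpleGraph.comap_adj, SimpleGraph.top_adj]
        decide }
  injective' := by
    change Function.Injective (Sum.elim _ _)
    decide

/-- For every edge `e` of `K_{4,3,1}`, the graph `K_{4,3,1} - e` contains `K_{4,4}`
with one edge deleted as a minor. -/
theorem k44_minus_edge_minor_of_k431_minus_edge
    (e : Sym2 (Σ i : Fin 3, Fin (![4, 3, 1] i)))
    (he : e ∈ (SimpleGraph.completeMultipartiteGraph
        (fun i : Fin 3 => Fin (![4, 3, 1] i))).edgeSet) :
    ∃ e' ∈ (completeBipartiteGraph (Fin 4) (Fin 4)).edgeSet,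
      ((completeBipartiteGraph (Fin 4) (Fin 4)).deleteEdges {e'}).IsMinorOf
        ((SimpleGraph.completeMultipartiteGraph
            (fun i : Fin 3 => Fin (![4, 3, 1] i))).deleteEdges {e}) := by
  obtain ⟨e', he', ⟨φ⟩⟩ := copyK44K431.exists_deleteEdges_copy
    ⟨s(Sum.inl 0, Sum.inr 0), by simp⟩ e
  exact ⟨e', he', φ.isMinorOf⟩
end
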